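/- Consider the two-sample testing problem with alternative parameters ε = ε_n ∈ (0,1/2) and μ = μ_n > 0 possibly varying with n. If √n ε_n · sup_{t∈ℝ} (F(t) − F(t − μ_n)) → 0 as n → ∞, then under the alternative H1 the normalized statistic √(mn/(m+n)) D_{m,n} converges in distribution to the same Kolmogorov limit law that it has under the null H0, so the two-sample Kolmogorov–Smirnov test is asymptotically powerless. -/

import Mathlib

open MeasureTheory ProbabilityTheory Filter Set Topology

/-- Empirical CDF of a sample of size `k`. -/
noncomputable def empCDF {k : ℕ} (x : Fin k → ℝ) (t : ℝ) : ℝ :=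
  ((Finset.univ.filter fun i => x i ≤ t).card : ℝ) / k

/-- The one-sided two-sample Kolmogorov–Smirnov statistic
`D_{m,n} = sup_t (F_m(t) − G_n(t))`. -/
noncomputable def KSstat {m n : ℕ} (x : Fin m → ℝ) (y : Fin n → ℝ) : ℝ :=
  ⨆ t : ℝ, (empCDF x t - empCDF y t)

lemma empCDF_eq_sum {k : ℕ} (x : Fin k → ℝ) (t : ℝ) :
    empCDF x t = (∑ i, if x i ≤ t then (1:ℝ) else 0) / k := by
  unfold empCDF
  congr 1
  simp

lemma empCDF_nonneg {k : ℕ} (x : Fin k → ℝ) (t : ℝ) : 0 ≤ empCDF x t := by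
  unfold empCDF; positivity

lemma empCDF_le_one {k : ℕ} (x : Fin k → ℝ) (t : ℝ) : empCDF x t ≤ 1 := by
  unfold empCDF
  apply div_le_one_of_le₀ _ (by positivity)
  have := Finset.card_filter_le (Finset.univ : Finset (Fin k)) (fun i => x i ≤ t)
  simp at this
  exact_mod_cast this

lemma empCDF_mono {k : ℕ} (x : Fin k → ℝ) {s t : ℝ} (h : s ≤ t) : empCDF x s ≤ empCDF x t := by
  unfold empCDF
  gcongr with i

lemma KS_bdd {m n : ℕ} (x : Fin m → ℝ) (y : Fin n → ℝ) :
    BddAbove (Set.range fun t : ℝ => empCDF x t - empCDF y t) := by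
  refine ⟨1, ?_⟩
  rintro _ ⟨t, rfl⟩
  have := empCDF_le_one x t
  have := empCDF_nonneg y t
  simp only; linarith

lemma le_KS {m n : ℕ} (x : Fin m → ℝ) (y : Fin n → ℝ) (t : ℝ) :
    empCDF x t - empCDF y t ≤ KSstat x y := le_ciSup (KS_bdd x y) t

lemma KS_le {m n : ℕ} (x : Fin m → ℝ) (y : Fin n → ℝ) (b : ℝ)
    (h : ∀ t, empCDF x t - empCDF y t ≤ b) : KSstat x y ≤ b := ciSup_le h

lemma empCDF_eq_zero {k : ℕ} (x : Fin k → ℝ) (t : ℝ) (h : ∀ i, t < x i) : empCDF x t = 0 := by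
  unfold empCDF
  rw [Finset.filter_false_of_mem]
  · simp
  · intro i _; exact not_le.2 (h i)

lemma empCDF_eq_one {k : ℕ} (hk : 0 < k) (x : Fin k → ℝ) (t : ℝ) (h : ∀ i, x i ≤ t) :
    empCDF x t = 1 := by
  unfold empCDF
  rw [Finset.filter_true_of_mem]
  · have : (k:ℝ) ≠ 0 := by positivity
    simp [this]
  · intro i _; exact h i

lemma KS_nonneg {m n : ℕ} (x : Fin m → ℝ) (y : Fin n → ℝ) : 0 ≤ KSstat x y := by
  obtain ⟨a, ha⟩ := (Set.finite_range x).bddBelow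
  obtain ⟨b, hb⟩ := (Set.finite_range y).bddBelow
  have h1 : empCDF x (min a b - 1) = 0 := empCDF_eq_zero _ _ fun i => by
    have := ha ⟨i, rfl⟩
    have := min_le_left a b
    linarith
  have h2 : empCDF y (min a b - 1) = 0 := empCDF_eq_zero _ _ fun i => by
    have := hb ⟨i, rfl⟩
    have := min_le_right a b
    linarith
  have := le_KS x y (min a b - 1)
  linarith

lemma measurable_empCDF_comp {α : Type*} [MeasurableSpace α] {k : ℕ} {f : α → Fin k → ℝ}
    {g : α → ℝ} (hf : Measurable f) (hg : Measurable g) :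
    Measurable (fun a => empCDF (f a) (g a)) := by
  simp_rw [empCDF_eq_sum]
  refine Measurable.div_const (Finset.measurable_sum _ fun i _ => ?_) _
  have : Measurable fun a => f a i := (measurable_pi_apply i).comp hf
  exact Measurable.ite (measurableSet_le this hg) measurable_const measurable_const

lemma empCDF_right {k : ℕ} (x : Fin k → ℝ) (t : ℝ) :
    ∀ᶠ s in 𝓝[>] t, empCDF x s = empCDF x t := by
  have : ∀ᶠ s in 𝓝[>] t, ∀ i, (x i ≤ s ↔ x i ≤ t) := by
    rw [eventually_all]
    intro i
    by_cases h : x i ≤ t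
    · filter_upwards [self_mem_nhdsWithin] with s hs
      have : t < s := hs
      simp [h, h.trans this.le]
    · have : ∀ᶠ s in 𝓝 t, s < x i := eventually_lt_nhds (not_le.1 h)
      filter_upwards [nhdsWithin_le_nhds this] with s hs
      simp [h, hs]
  filter_upwards [this] with s hs
  unfold empCDF
  simp [hs]

lemma KS_le_iff {m n : ℕ} (x : Fin m → ℝ) (y : Fin n → ℝ) (b : ℝ) :
    KSstat x y ≤ b ↔ ∀ q : ℚ, empCDF x q - empCDF y q ≤ b := by
  constructor
  · intro h q
    exact (le_KS x y q).trans h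
  · intro h
    refine KS_le _ _ _ fun t => ?_
    obtain ⟨u, hu, hu2⟩ := (mem_nhdsGT_iff_exists_Ioo_subset).1
      ((empCDF_right x t).and (empCDF_right y t))
    obtain ⟨q, hq⟩ := exists_rat_btwn (show t < u from hu)
    have := hu2 ⟨hq.1, hq.2⟩
    simp only [mem_ofPred_eq] at this
    rw [← this.1, ← this.2]
    exact h q

lemma measurable_KS {m n : ℕ} :
    Measurable (fun p : (Fin m → ℝ) × (Fin n → ℝ) => KSstat p.1 p.2) := by
  refine measurable_of_Iic fun b => ?_
  have : (fun p : (Fin m → ℝ) × (Fin n → ℝ) => KSstat p.1 p.2) ⁻¹' Iic b =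
      ⋂ q : ℚ, {p | empCDF p.1 q - empCDF p.2 q ≤ b} := by
    ext p
    simp [KS_le_iff]
  rw [this]
  refine MeasurableSet.iInter fun q => measurableSet_le ?_ measurable_const
  refine Measurable.sub ?_ ?_
  · exact measurable_empCDF_comp measurable_fst measurable_const
  · exact measurable_empCDF_comp measurable_snd measurable_const

/-- uniform law -/
noncomputable def lam : Measure ℝ := volume.restrict (Ioc 0 1)

instance : IsProbabilityMeasure lam := ⟨by simp [lam]⟩

/-- rotation -/
noncomputable def rot (s u : ℝ) : ℝ := if u ≤ s then u + (1 - s) else u - s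

lemma measurable_rot : Measurable (fun p : ℝ × ℝ => rot p.1 p.2) := by
  unfold rot
  exact Measurable.ite (measurableSet_le (by fun_prop) (by fun_prop)) (by fun_prop) (by fun_prop)

lemma mp_rot (s : ℝ) (hs : s ∈ Ioc (0:ℝ) 1) : MeasurePreserving (rot s) lam lam := by
  have hm : Measurable (rot s) := measurable_rot.comp (measurable_const.prodMk measurable_id)
  refine ⟨hm, ?_⟩
  ext A hA
  rw [Measure.map_apply hm hA]
  unfold lam
  rw [Measure.restrict_apply (hm hA), Measure.restrict_apply hA]
  have e1 : rot s ⁻¹' A ∩ Ioc 0 1 =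
      ((fun u => u + (1 - s)) ⁻¹' (A ∩ Ioc (1 - s) 1)) ∪
        ((fun u => u + (- s)) ⁻¹' (A ∩ Ioc 0 (1 - s))) := by
    ext u
    simp only [rot, mem_inter_iff, mem_preimage, mem_Ioc, mem_union]
    have := hs.1
    have := hs.2
    split_ifs with h
    · constructor
      · rintro ⟨h1, h2, h3⟩
        left; refine ⟨h1, by linarith, by linarith⟩
      · rintro (⟨h1, h2, h3⟩ | ⟨h1, h2, h3⟩)
        · refine ⟨h1, by linarith, by linarith⟩
        · linarith
    · constructor
      · rintro ⟨h1, h2, h3⟩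
        right; refine ⟨h1, by linarith, by linarith⟩
      · rintro (⟨h1, h2, h3⟩ | ⟨h1, h2, h3⟩)
        · linarith
        · refine ⟨h1, by linarith, by linarith⟩
  have e2 : A ∩ Ioc 0 1 = (A ∩ Ioc (1 - s) 1) ∪ (A ∩ Ioc 0 (1 - s)) := by
    rw [← inter_union_distrib_left, union_comm, Ioc_union_Ioc_eq_Ioc]
    · linarith [hs.2]
    · linarith [hs.1]
  rw [e1, e2, measure_union, measure_union, measure_preimage_add_right, measure_preimage_add_right]
  · refine Set.disjoint_left.2 ?_
    rintro a ⟨_, ha⟩ ⟨_, hb⟩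
    exact absurd ha.1 (not_lt.2 hb.2)
  · exact hA.inter measurableSet_Ioc
  · refine Set.disjoint_left.2 ?_
    rintro a ⟨_, ha⟩ ⟨_, hb⟩
    have h1 := ha.2
    have h2 := hb.1
    simp only at h1 h2
    linarith
  · exact (measurable_id.add_const _) (hA.inter measurableSet_Ioc)

lemma empCDF_rot {k : ℕ} (hk : 0 < k) (u : Fin k → ℝ) (hu : ∀ i, u i ∈ Ioc (0:ℝ) 1) (s t : ℝ)
    (hs : s ∈ Ioc (0:ℝ) 1) (ht0 : 0 ≤ t) (ht1 : t ≤ 1) :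
    empCDF (fun i => rot s (u i)) t =
      if t ≤ 1 - s then empCDF u (s + t) - empCDF u s
      else 1 - empCDF u s + empCDF u (t - 1 + s) := by
  have hone : (1:ℝ) = (∑ i : Fin k, (1:ℝ)) / k := by
    simp; field_simp
  rw [hone]
  simp only [empCDF_eq_sum, ← sub_div, ← add_div, ← Finset.sum_sub_distrib,
    ← Finset.sum_add_distrib]
  rw [← hone]
  have h1 := hs.1
  have h2 := hs.2
  rw [← apply_ite (fun z : ℝ => z / (k:ℝ))]
  congr 1
  split_ifs with h
  all_goals
    refine Finset.sum_congr rfl fun i _ => ?_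
    have := (hu i).1
    have := (hu i).2
    unfold rot
    split_ifs <;> linarith

lemma KS_rot {m n : ℕ} (hm : 0 < m) (hn : 0 < n) (u : Fin m → ℝ) (v : Fin n → ℝ)
    (hu : ∀ i, u i ∈ Ioc (0:ℝ) 1) (hv : ∀ i, v i ∈ Ioc (0:ℝ) 1) (s : ℝ)
    (hs : s ∈ Ioc (0:ℝ) 1) :
    KSstat (fun i => rot s (u i)) (fun i => rot s (v i)) =
      KSstat u v - (empCDF u s - empCDF v s) := by
  have h1 := hs.1
  have h2 := hs.2
  have key : ∀ {k : ℕ} (hk : 0 < k) (u : Fin k → ℝ) (hu : ∀ i, u i ∈ Ioc (0:ℝ) 1),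
    (∀ i, rot s (u i) ∈ Ioc (0:ℝ) 1) := by
    intro k hk u hu i
    have := (hu i).1
    have := (hu i).2
    unfold rot
    split_ifs <;> constructor <;> linarith
  have hb : ∀ (a : Fin m → ℝ) (b : Fin n → ℝ) (ha : ∀ i, a i ∈ Ioc (0:ℝ) 1)
      (hb : ∀ i, b i ∈ Ioc (0:ℝ) 1) (z : ℝ)
      (h : ∀ t, 0 ≤ t → t ≤ 1 → empCDF a t - empCDF b t ≤ z), KSstat a b ≤ z := by
    intro a b ha hb z h
    refine KS_le _ _ _ fun t => ?_
    by_cases h0 : 0 ≤ t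
    · by_cases h1 : t ≤ 1
      · exact h t h0 h1
      · have := h 1 (by norm_num) le_rfl
        rw [empCDF_eq_one hm a 1 (fun i => (ha i).2), empCDF_eq_one hn b 1 (fun i => (hb i).2)]
          at this
        rw [empCDF_eq_one hm a t (fun i => (ha i).2.trans (by linarith)),
          empCDF_eq_one hn b t (fun i => (hb i).2.trans (by linarith))]
        exact this
    · have := h 1 (by norm_num) le_rfl
      rw [empCDF_eq_one hm a 1 (fun i => (ha i).2), empCDF_eq_one hn b 1 (fun i => (hb i).2)]
          at this
      rw [empCDF_eq_zero a t (fun i => by linarith [(ha i).1]),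
        empCDF_eq_zero b t (fun i => by linarith [(hb i).1])]
      linarith
  apply le_antisymm
  · refine hb _ _ (key hm u hu) (key hn v hv) _ fun t h0 h1 => ?_
    rw [empCDF_rot hm u hu s t hs h0 h1, empCDF_rot hn v hv s t hs h0 h1]
    split_ifs
    · have := le_KS u v (s + t)
      linarith
    · have := le_KS u v (t - 1 + s)
      linarith
  · rw [sub_le_iff_le_add]
    refine hb _ _ hu hv _ fun t h0 h1 => ?_
    by_cases hts : s ≤ t
    · have := le_KS (fun i => rot s (u i)) (fun i => rot s (v i)) (t - s)
      rw [empCDF_rot hm u hu s _ hs (by linarith) (by linarith),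
        empCDF_rot hn v hv s _ hs (by linarith) (by linarith), if_pos (by linarith),
        if_pos (by linarith)] at this
      simp only [add_sub_cancel] at this
      linarith
    · by_cases ht0 : t = 0
      · subst ht0
        rw [empCDF_eq_zero u 0 (fun i => by linarith [(hu i).1]),
          empCDF_eq_zero v 0 (fun i => by linarith [(hv i).1])]
        have := le_KS (fun i => rot s (u i)) (fun i => rot s (v i)) (1 - s)
        rw [empCDF_rot hm u hu s _ hs (by linarith) (by linarith),
          empCDF_rot hn v hv s _ hs (by linarith) (by linarith), if_pos (by linarith),
          if_pos (by linarith)] at this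
        simp only [add_sub_cancel] at this
        rw [empCDF_eq_one hm u 1 (fun i => (hu i).2), empCDF_eq_one hn v 1 (fun i => (hv i).2)]
          at this
        linarith
      · have : 0 < t := lt_of_le_of_ne h0 (Ne.symm ht0)
        have := le_KS (fun i => rot s (u i)) (fun i => rot s (v i)) (t + 1 - s)
        rw [empCDF_rot hm u hu s _ hs (by linarith) (by linarith),
          empCDF_rot hn v hv s _ hs (by linarith) (by linarith), if_neg (by linarith),
          if_neg (by linarith)] at this
        have e : t + 1 - s - 1 + s = t := by ring
        rw [e] at this
        linarith

/-- number of sample points in `A` -/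
noncomputable def cnt {n : ℕ} (A : Set ℝ) (v : Fin n → ℝ) : ℤ :=
  ∑ i, A.indicator (fun _ => (1:ℤ)) (v i)

lemma measurable_cnt {n : ℕ} {A : Set ℝ} (hA : MeasurableSet A) :
    Measurable (cnt (n := n) A) := by
  unfold cnt
  refine Finset.measurable_sum _ fun i _ => ?_
  exact (measurable_const.indicator hA).comp (measurable_pi_apply i)

lemma fourier_int (j : ℤ) :
    ∫ t in (-Real.pi)..Real.pi, Complex.exp (((t * j : ℝ) : ℂ) * Complex.I) =
      if j = 0 then ((2 * Real.pi : ℝ) : ℂ) else 0 := by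
  split_ifs with h
  · subst h
    simp
    ring
  · have hc : ((j:ℂ) * Complex.I) ≠ 0 := by
      simp [h]
    have : ∀ t : ℝ, Complex.exp (((t * j : ℝ) : ℂ) * Complex.I) =
        Complex.exp ((j:ℂ) * Complex.I * t) := by
      intro t; congr 1; push_cast; ring
    simp_rw [this]
    rw [integral_exp_mul_complex hc]
    rw [div_eq_zero_iff]; left
    rw [sub_eq_zero, Complex.exp_eq_exp_iff_exists_int]
    refine ⟨j, ?_⟩
    push_cast; ring

lemma phi_eq {A : Set ℝ} (hA : MeasurableSet A) (z : ℂ) :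
    ∫ v, (1 + A.indicator (fun _ => z - 1) v) ∂lam = 1 + lam.real A * (z - 1) := by
  rw [integral_add (integrable_const _) ((integrable_const _).indicator hA),
    integral_indicator_const _ hA]
  simp

lemma prod_exp {n : ℕ} {A : Set ℝ} (hA : MeasurableSet A) (w : ℂ) :
    ∫ v : Fin n → ℝ, Complex.exp (w * (cnt A v : ℂ)) ∂(Measure.pi fun _ => lam) =
      (1 + lam.real A * (Complex.exp w - 1)) ^ n := by
  rw [← phi_eq hA]
  have := integral_fintype_prod_eq_pow (ι := Fin n) (𝕜 := ℂ) (μ := lam)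
    (fun v => 1 + A.indicator (fun _ => Complex.exp w - 1) v)
  rw [Fintype.card_fin] at this
  rw [← this]
  congr 1
  ext v
  unfold cnt
  push_cast
  rw [Finset.mul_sum, Complex.exp_sum]
  refine Finset.prod_congr rfl fun i _ => ?_
  by_cases h : v i ∈ A <;> simp [h]

lemma norm_phi (p t : ℝ) (hp0 : 0 ≤ p) (hp1 : p ≤ 1) (ht : |t| ≤ Real.pi) :
    ‖(1 + (p:ℂ) * (Complex.exp (t * Complex.I) - 1))‖ ≤
      Real.exp (-(2 * p * (1 - p) / Real.pi ^ 2) * t ^ 2) := by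
  rw [← pow_le_pow_iff_left₀ (norm_nonneg _) (Real.exp_pos _).le two_ne_zero, ← Real.exp_nat_mul,
    Complex.sq_norm, Complex.normSq_apply]
  have hc := Real.cos_le_one_sub_mul_cos_sq ht
  have hs := Real.sin_sq_add_cos_sq t
  simp only [Complex.add_re, Complex.one_re, Complex.mul_re, Complex.ofReal_re, Complex.sub_re,
    Complex.exp_ofReal_mul_I_re, Complex.ofReal_im, Complex.sub_im, Complex.exp_ofReal_mul_I_im,
    Complex.one_im, Complex.add_im, Complex.mul_im]
  have h1 := Real.add_one_le_exp ((2:ℕ) * (-(2 * p * (1 - p) / Real.pi ^ 2) * t ^ 2))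
  refine le_trans ?_ h1
  have h2 : 0 ≤ p * (1 - p) := mul_nonneg hp0 (by linarith)
  have h3 := mul_le_mul_of_nonneg_left hc h2
  have e : (1 + (p * (Real.cos t - 1) - 0 * (Real.sin t - 0))) *
      (1 + (p * (Real.cos t - 1) - 0 * (Real.sin t - 0))) +
      (0 + (p * (Real.sin t - 0) + 0 * (Real.cos t - 1))) *
      (0 + (p * (Real.sin t - 0) + 0 * (Real.cos t - 1))) =
      1 - 2 * (p * (1 - p)) + 2 * (p * (1 - p) * Real.cos t) := by
    linear_combination p ^ 2 * hs
  rw [e]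
  have e2 : ((2:ℕ):ℝ) * (-(2 * p * (1 - p) / Real.pi ^ 2) * t ^ 2) + 1 =
     1 - 2 * (p * (1 - p)) + 2 * (p * (1 - p) * (1 - 2 / Real.pi ^ 2 * t ^ 2)) := by
    push_cast; ring
  rw [e2]
  linarith

lemma bin_pt {n : ℕ} (hn : 0 < n) {A : Set ℝ} (hA : MeasurableSet A) (k : ℤ)
    (hp0 : 0 < lam.real A) (hp1 : lam.real A < 1) :
    (Measure.pi fun _ : Fin n => lam).real {v | cnt A v = k} ≤
      1 / Real.sqrt (n * (lam.real A * (1 - lam.real A))) := by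
  set p := lam.real A with hp
  set M := Measure.pi fun _ : Fin n => lam with hM
  have hpi := Real.pi_pos
  have hmS : MeasurableSet {v : Fin n → ℝ | cnt A v = k} :=
    measurable_cnt hA (measurableSet_singleton k)
  have key : (((2 * Real.pi * M.real {v | cnt A v = k} : ℝ)) : ℂ) =
      ∫ t in (-Real.pi)..Real.pi, ∫ v, Complex.exp (((t * (cnt A v - k : ℤ) : ℝ) : ℂ) * Complex.I) ∂M := by
    rw [intervalIntegral_integral_swap]
    · simp_rw [fourier_int]
      have : (fun v : Fin n → ℝ => if cnt A v - k = 0 then ((2 * Real.pi : ℝ) : ℂ) else 0) =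
          {v : Fin n → ℝ | cnt A v = k}.indicator (fun _ => ((2 * Real.pi : ℝ) : ℂ)) := by
        ext v
        simp [Set.indicator_apply, sub_eq_zero]
      rw [this, integral_indicator_const _ hmS]
      simp
      ring
    · have : IsFiniteMeasure
          ((volume : Measure ℝ).restrict (Set.uIoc (-Real.pi) Real.pi)) := by
        rw [uIoc_of_le (by linarith)]; infer_instance
      refine Integrable.of_bound (C := 1) ?_ ?_
      · apply Measurable.aestronglyMeasurable
        have h1 : Measurable fun q : ℝ × (Fin n → ℝ) => ((cnt A q.2 - k : ℤ) : ℝ) := by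
          have : Measurable fun z : ℤ => ((z - k : ℤ) : ℝ) := measurable_from_top
          exact this.comp ((measurable_cnt hA).comp measurable_snd)
        have h2 := measurable_fst.mul h1
        exact Complex.measurable_exp.comp ((Complex.measurable_ofReal.comp h2).mul_const _)
      · refine ae_of_all _ fun q => ?_
        simp only [Function.uncurry]
        rw [Complex.norm_exp_ofReal_mul_I]
  have hb : ∀ t ∈ Set.uIoc (-Real.pi) Real.pi,
      ‖∫ v, Complex.exp (((t * (cnt A v - k : ℤ) : ℝ) : ℂ) * Complex.I) ∂M‖ ≤
        Real.exp (-(n * (2 * p * (1 - p) / Real.pi ^ 2)) * t ^ 2) := by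
    intro t ht
    have e : ∀ v : Fin n → ℝ, Complex.exp (((t * (cnt A v - k : ℤ) : ℝ) : ℂ) * Complex.I) =
        Complex.exp (((-(t * k) : ℝ) : ℂ) * Complex.I) * Complex.exp (t * Complex.I * (cnt A v : ℂ)) := by
      intro v
      rw [← Complex.exp_add]; congr 1; push_cast; ring
    simp_rw [e]
    rw [integral_const_mul, norm_mul, Complex.norm_exp_ofReal_mul_I, one_mul, prod_exp hA, norm_pow]
    rw [uIoc_of_le (by linarith)] at ht
    have := norm_phi p t hp0.le hp1.le (abs_le.2 ⟨ht.1.le, ht.2⟩)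
    refine (pow_le_pow_left₀ (norm_nonneg _) this n).trans ?_
    rw [← Real.exp_nat_mul]
    apply le_of_eq; congr 1; ring
  have hn' : (0:ℝ) < n := by exact_mod_cast hn
  have hpq : 0 < p * (1 - p) := mul_pos hp0 (by linarith)
  have hbpos : 0 < n * (2 * p * (1 - p) / Real.pi ^ 2) := by
    have : 2 * p * (1 - p) = 2 * (p * (1 - p)) := by ring
    rw [this]; positivity
  have h1 : 2 * Real.pi * M.real {v | cnt A v = k} ≤
      Real.sqrt (Real.pi / (n * (2 * p * (1 - p) / Real.pi ^ 2))) := by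
    rw [← integral_gaussian]
    have h2 : ‖(((2 * Real.pi * M.real {v | cnt A v = k} : ℝ)) : ℂ)‖ =
        2 * Real.pi * M.real {v | cnt A v = k} := by
      rw [Complex.norm_real, Real.norm_of_nonneg]
      positivity
    rw [← h2, key]
    refine (intervalIntegral.norm_integral_le_integral_norm (by linarith)).trans ?_
    rw [intervalIntegral.integral_of_le (by linarith)]
    have hint := integrable_exp_neg_mul_sq hbpos
    refine le_trans ?_ (setIntegral_le_integral (s := Ioc (-Real.pi) Real.pi) hint
      (ae_of_all _ fun t => (Real.exp_pos _).le))
    apply integral_mono_of_nonneg (ae_of_all _ fun t => norm_nonneg _) hint.integrableOn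
    refine (ae_restrict_iff' measurableSet_Ioc).2 (ae_of_all _ fun t ht => ?_)
    exact hb t (by rwa [uIoc_of_le (by linarith)])
  have h3 : Real.sqrt (Real.pi / (n * (2 * p * (1 - p) / Real.pi ^ 2))) ≤
      2 * Real.pi * (1 / Real.sqrt (n * (p * (1 - p)))) := by
    rw [Real.sqrt_le_left (by positivity), mul_pow, div_pow, Real.sq_sqrt (by positivity)]
    have : Real.pi / (n * (2 * p * (1 - p) / Real.pi ^ 2)) =
       Real.pi ^ 3 / 2 * (1 / (n * (p * (1 - p)))) := by
      have : 1 - p ≠ 0 := by linarith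
      field_simp
    rw [this, one_pow]
    gcongr
    have := Real.pi_lt_d2
    nlinarith [sq_nonneg Real.pi]
  have := h1.trans h3
  exact le_of_mul_le_mul_left this (by positivity)

lemma bin_win {n : ℕ} (hn : 0 < n) {A : Set ℝ} (hA : MeasurableSet A) (a b : ℝ) (hab : a ≤ b)
    (hp0 : 0 < lam.real A) (hp1 : lam.real A < 1) :
    (Measure.pi fun _ : Fin n => lam).real {v | a ≤ cnt A v ∧ (cnt A v : ℝ) ≤ b} ≤
      (b - a + 1) / Real.sqrt (n * (lam.real A * (1 - lam.real A))) := by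
  have hsub : {v : Fin n → ℝ | a ≤ cnt A v ∧ (cnt A v : ℝ) ≤ b} ⊆
      ⋃ k ∈ Finset.Icc ⌈a⌉ ⌊b⌋, {v | cnt A v = k} := by
    rintro v ⟨h1, h2⟩
    simp only [mem_iUnion, Finset.mem_Icc]
    exact ⟨cnt A v, ⟨Int.ceil_le.2 h1, Int.le_floor.2 h2⟩, rfl⟩
  refine (measureReal_mono hsub (measure_ne_top _ _)).trans ?_
  refine (measureReal_biUnion_finset_le _ _).trans ?_
  refine (Finset.sum_le_sum fun k _ => bin_pt hn hA k hp0 hp1).trans ?_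
  rw [Finset.sum_const, nsmul_eq_mul, mul_one_div]
  gcongr
  rw [Int.card_Icc]
  have h1 := Int.le_ceil a
  have h2 := Int.floor_le b
  rcases le_total 0 (⌊b⌋ + 1 - ⌈a⌉) with h | h
  · have : (((⌊b⌋ + 1 - ⌈a⌉).toNat : ℤ) : ℝ) = ((⌊b⌋ + 1 - ⌈a⌉ : ℤ) : ℝ) := by
      rw [Int.toNat_of_nonneg h]
    rw [Int.cast_natCast] at this
    rw [this]; push_cast; linarith
  · rw [Int.toNat_of_nonpos h]; push_cast; linarith

lemma chernoff {n : ℕ} {A : Set ℝ} (hA : MeasurableSet A) (a : ℝ) :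
    (Measure.pi fun _ : Fin n => lam).real {v | a ≤ (cnt A v : ℝ)} ≤
      Real.exp (2 * n * lam.real A - a) := by
  set M := Measure.pi fun _ : Fin n => lam with hM
  have hm : Measurable fun v : Fin n → ℝ => (cnt A v : ℝ) := by
    have : Measurable fun z : ℤ => (z : ℝ) := measurable_from_top
    exact this.comp (measurable_cnt hA)
  have hbd : ∀ v : Fin n → ℝ, (cnt A v : ℝ) ≤ n := by
    intro v
    have : cnt A v ≤ n := by
      unfold cnt
      refine (Finset.sum_le_card_nsmul _ _ 1 fun i _ => ?_).trans (by simp)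
      by_cases h : v i ∈ A <;> simp [h]
    exact_mod_cast this
  have hint : Integrable (fun v : Fin n → ℝ => Real.exp (cnt A v)) M := by
    refine Integrable.of_bound (C := Real.exp n) (Real.measurable_exp.comp hm).aestronglyMeasurable
      (ae_of_all _ fun v => ?_)
    rw [Real.norm_of_nonneg (Real.exp_pos _).le]
    exact Real.exp_le_exp.2 (hbd v)
  have h1 := mul_meas_ge_le_integral_of_nonneg (ae_of_all _ fun v => (Real.exp_pos _).le) hint
    (Real.exp a)
  have h2 : ∫ v, Real.exp (cnt A v) ∂M = (1 + lam.real A * (Real.exp 1 - 1)) ^ n := by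
    have := prod_exp (n := n) hA 1
    apply Complex.ofReal_injective
    rw [← integral_complex_ofReal]
    push_cast
    simpa using this
  have h3 : (1 + lam.real A * (Real.exp 1 - 1)) ^ n ≤ Real.exp (2 * n * lam.real A) := by
    have hp : 0 ≤ lam.real A := measureReal_nonneg
    have he := Real.exp_one_lt_d9
    have he' := Real.add_one_le_exp (1:ℝ)
    have : 1 + lam.real A * (Real.exp 1 - 1) ≤ Real.exp (2 * lam.real A) := by
      have := Real.add_one_le_exp (2 * lam.real A)
      nlinarith
    refine (pow_le_pow_left₀ (by nlinarith) this n).trans ?_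
    rw [← Real.exp_nat_mul]
    apply le_of_eq; congr 1; ring
  rw [h2] at h1
  have h4 : {v : Fin n → ℝ | Real.exp a ≤ Real.exp (cnt A v)} = {v | a ≤ (cnt A v : ℝ)} := by
    ext v; simp
  rw [h4] at h1
  rw [Real.exp_sub, le_div_iff₀ (Real.exp_pos _), mul_comm]
  exact h1.trans h3

/-- the null law in uniform coordinates -/
noncomputable def Lam (m n : ℕ) : Measure ((Fin m → ℝ) × (Fin n → ℝ)) :=
  (Measure.pi fun _ : Fin m => lam).prod (Measure.pi fun _ : Fin n => lam)

instance (m n : ℕ) : IsProbabilityMeasure (Lam m n) := by unfold Lam; infer_instance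

lemma lam_ae_Ioo : ∀ᵐ u ∂lam, u ∈ Ioo (0:ℝ) 1 := by
  unfold lam
  rw [← Measure.restrict_congr_set Ioo_ae_eq_Ioc]
  exact ae_restrict_mem measurableSet_Ioo

lemma pi_lam_ae (k : ℕ) : ∀ᵐ u ∂(Measure.pi fun _ : Fin k => lam), ∀ i, u i ∈ Ioo (0:ℝ) 1 := by
  rw [ae_all_iff]
  intro i
  exact (measurePreserving_eval (fun _ : Fin k => lam) i).quasiMeasurePreserving.ae lam_ae_Ioo

lemma Lam_ae (m n : ℕ) : ∀ᵐ ω ∂(Lam m n), (∀ i, ω.1 i ∈ Ioo (0:ℝ) 1) ∧ ∀ i, ω.2 i ∈ Ioo (0:ℝ) 1 := by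
  unfold Lam
  exact (Measure.quasiMeasurePreserving_fst.ae (pi_lam_ae m)).and
    (Measure.quasiMeasurePreserving_snd.ae (pi_lam_ae n))

/-- difference process -/
noncomputable def Wp {m n : ℕ} (ω : (Fin m → ℝ) × (Fin n → ℝ)) (s : ℝ) : ℝ :=
  empCDF ω.1 s - empCDF ω.2 s

lemma measurable_Wp_comp {α : Type*} [MeasurableSpace α] {m n : ℕ}
    {f : α → (Fin m → ℝ) × (Fin n → ℝ)}
    {g : α → ℝ} (hf : Measurable f) (hg : Measurable g) :
    Measurable (fun a => Wp (f a) (g a)) :=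
  (measurable_empCDF_comp (measurable_fst.comp hf) hg).sub
    (measurable_empCDF_comp (measurable_snd.comp hf) hg)

lemma measurable_KS_comp {α : Type*} [MeasurableSpace α] {m n : ℕ}
    {f : α → (Fin m → ℝ) × (Fin n → ℝ)} (hf : Measurable f) :
    Measurable (fun a => KSstat (f a).1 (f a).2) :=
  (measurable_KS (m := m) (n := n)).comp hf

lemma rot_inv {m n : ℕ} (hm : 0 < m) (hn : 0 < n) (I : Set ℝ) (hI : MeasurableSet I) (a s : ℝ)
    (hs : s ∈ Ioc (0:ℝ) 1) :
    Lam m n {ω | a * (KSstat ω.1 ω.2 - Wp ω s) ∈ I} = Lam m n {ω | a * KSstat ω.1 ω.2 ∈ I} := by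
  have hp : MeasurePreserving (Prod.map (fun (u : Fin m → ℝ) i => rot s (u i))
      (fun (u : Fin n → ℝ) i => rot s (u i))) (Lam m n) (Lam m n) :=
    (measurePreserving_pi _ _ fun _ => mp_rot s hs).prod
      (measurePreserving_pi _ _ fun _ => mp_rot s hs)
  have hmS : MeasurableSet {ω : (Fin m → ℝ) × (Fin n → ℝ) | a * KSstat ω.1 ω.2 ∈ I} :=
    (measurable_KS.const_mul a) hI
  rw [← hp.measure_preimage hmS.nullMeasurableSet]
  apply measure_congr
  filter_upwards [Lam_ae m n] with ω hω
  have e := KS_rot hm hn ω.1 ω.2 (fun i => Ioo_subset_Ioc_self (hω.1 i))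
    (fun i => Ioo_subset_Ioc_self (hω.2 i)) s hs
  apply propext
  change a * (KSstat ω.1 ω.2 - Wp ω s) ∈ I ↔
    a * KSstat (fun i => rot s (ω.1 i)) (fun i => rot s (ω.2 i)) ∈ I
  rw [e]; rfl

lemma occ {m n : ℕ} (hm : 0 < m) (hn : 0 < n) (a x c δ : ℝ) (hδ : 0 < δ) :
    Lam m n {ω | a * KSstat ω.1 ω.2 ∈ Ioc (x - c) x} ≤
      ENNReal.ofReal δ + (ENNReal.ofReal δ)⁻¹ *
        ∫⁻ q, Lam m n {ω | |a * (Wp ω q.1 - Wp ω q.2)| ≤ c} ∂(lam.prod lam) := by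
  set E : Set (ℝ × ((Fin m → ℝ) × (Fin n → ℝ))) :=
    {z | a * (KSstat z.2.1 z.2.2 - Wp z.2 z.1) ∈ Ioc (x - c) x} with hE
  have hEm : MeasurableSet E := by
    have h1 : Measurable fun z : ℝ × ((Fin m → ℝ) × (Fin n → ℝ)) =>
        a * (KSstat z.2.1 z.2.2 - Wp z.2 z.1) :=
      ((measurable_KS_comp measurable_snd).sub
        (measurable_Wp_comp measurable_snd measurable_fst)).const_mul a
    exact h1 measurableSet_Ioc
  set H : Set ((ℝ × ℝ) × ((Fin m → ℝ) × (Fin n → ℝ))) :=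
    {z | |a * (Wp z.2 z.1.1 - Wp z.2 z.1.2)| ≤ c} with hH
  have hHm : MeasurableSet H := by
    have h1 : Measurable fun z : (ℝ × ℝ) × ((Fin m → ℝ) × (Fin n → ℝ)) =>
        a * (Wp z.2 z.1.1 - Wp z.2 z.1.2) :=
      ((measurable_Wp_comp measurable_snd (measurable_fst.comp measurable_fst)).sub
        (measurable_Wp_comp measurable_snd (measurable_snd.comp measurable_fst))).const_mul a
    exact measurableSet_le h1.abs measurable_const
  have e1 : Lam m n {ω | a * KSstat ω.1 ω.2 ∈ Ioc (x - c) x} = (lam.prod (Lam m n)) E := by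
    rw [Measure.prod_apply hEm]
    have : ∀ᵐ s ∂lam, Lam m n (Prod.mk s ⁻¹' E) =
        Lam m n {ω | a * KSstat ω.1 ω.2 ∈ Ioc (x - c) x} := by
      filter_upwards [lam_ae_Ioo] with s hs
      exact rot_inv hm hn _ measurableSet_Ioc a s (Ioo_subset_Ioc_self hs)
    rw [lintegral_congr_ae this]
    simp
  have e2 : ∫⁻ q, Lam m n {ω | |a * (Wp ω q.1 - Wp ω q.2)| ≤ c} ∂(lam.prod lam) =
      ((lam.prod lam).prod (Lam m n)) H := by
    rw [Measure.prod_apply hHm]; rfl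
  rw [e1, e2, Measure.prod_apply_symm hEm, Measure.prod_apply_symm hHm]
  have hpt : ∀ ω : (Fin m → ℝ) × (Fin n → ℝ), lam ((fun s => (s, ω)) ⁻¹' E) ≤
      ENNReal.ofReal δ + (ENNReal.ofReal δ)⁻¹ * (lam.prod lam) ((fun q => (q, ω)) ⁻¹' H) := by
    intro ω
    set L := (fun s => (s, ω)) ⁻¹' E with hL
    have h1 : lam L * lam L ≤ (lam.prod lam) ((fun q => (q, ω)) ⁻¹' H) := by
      rw [← Measure.prod_prod]
      apply measure_mono
      rintro ⟨s, s'⟩ ⟨h1, h2⟩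
      have h1 : a * (KSstat ω.1 ω.2 - Wp ω s) ∈ Ioc (x - c) x := h1
      have h2 : a * (KSstat ω.1 ω.2 - Wp ω s') ∈ Ioc (x - c) x := h2
      change |a * (Wp ω s - Wp ω s')| ≤ c
      rw [abs_le]
      constructor
      · linarith [h1.2, h2.1]
      · linarith [h1.1, h2.2]
    rcases le_total (lam L) (ENNReal.ofReal δ) with h | h
    · exact h.trans le_self_add
    · refine le_trans ?_ le_add_self
      have hδ0 : ENNReal.ofReal δ ≠ 0 := by simpa using hδ
      calc lam L = (ENNReal.ofReal δ)⁻¹ * (ENNReal.ofReal δ * lam L) := by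
            rw [← mul_assoc, ENNReal.inv_mul_cancel hδ0 ENNReal.ofReal_ne_top, one_mul]
        _ ≤ (ENNReal.ofReal δ)⁻¹ * (lam L * lam L) := by gcongr
        _ ≤ _ := by gcongr
  refine (lintegral_mono hpt).trans ?_
  rw [lintegral_add_left measurable_const, lintegral_const_mul _ (measurable_measure_prodMk_right hHm)]
  simp

lemma emp_diff {k : ℕ} (v : Fin k → ℝ) {s s' : ℝ} (h : s ≤ s') :
    empCDF v s' - empCDF v s = (cnt (Ioc s s') v : ℝ) / k := by
  rw [empCDF_eq_sum, empCDF_eq_sum, ← sub_div, ← Finset.sum_sub_distrib]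
  unfold cnt
  push_cast
  congr 1
  refine Finset.sum_congr rfl fun i _ => ?_
  simp only [indicator_apply, mem_Ioc]
  by_cases h1 : v i ≤ s
  · simp [h1, h1.trans h, not_lt.2 h1]
  · by_cases h2 : v i ≤ s' <;> simp [h1, h2, not_le.1 h1]

lemma lam_Ioc {s s' : ℝ} (h0 : 0 ≤ s) (h : s ≤ s') (h1 : s' ≤ 1) : lam.real (Ioc s s') = s' - s := by
  unfold lam
  rw [measureReal_restrict_apply measurableSet_Ioc, inter_eq_left.2 (Ioc_subset_Ioc h0 h1)]
  simp [h]

lemma pair_bd {m n : ℕ} (hn : 0 < n) (a c θ : ℝ) (hc : 0 < c) (hθ0 : 0 < θ)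
    (ha : Real.sqrt (n / 2) ≤ a) (s s' : ℝ) (hs : 0 ≤ s) (hs' : s' ≤ 1) (h1 : θ ≤ s' - s)
    (h2 : s' - s ≤ 1 - θ) :
    Lam m n {ω | |a * (Wp ω s' - Wp ω s)| ≤ c} ≤
      ENNReal.ofReal ((3 * c * Real.sqrt n + 1) / Real.sqrt (n * (θ / 2))) := by
  have hn' : (0:ℝ) < n := by exact_mod_cast hn
  have hss : s ≤ s' := by linarith
  have hp := lam_Ioc hs hss hs'
  have hapos : 0 < a := lt_of_lt_of_le (Real.sqrt_pos.2 (by positivity)) ha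
  have hSm : MeasurableSet {ω : (Fin m → ℝ) × (Fin n → ℝ) | |a * (Wp ω s' - Wp ω s)| ≤ c} := by
    have h1 : Measurable fun ω : (Fin m → ℝ) × (Fin n → ℝ) => a * (Wp ω s' - Wp ω s) :=
      ((measurable_Wp_comp measurable_id measurable_const).sub
        (measurable_Wp_comp measurable_id measurable_const)).const_mul a
    exact measurableSet_le h1.abs measurable_const
  unfold Lam
  rw [Measure.prod_apply hSm]
  set B := (3 * c * Real.sqrt n + 1) / Real.sqrt (n * (θ / 2)) with hB
  have key : ∀ u : Fin m → ℝ, (Measure.pi fun _ : Fin n => lam)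
      (Prod.mk u ⁻¹' {ω | |a * (Wp ω s' - Wp ω s)| ≤ c}) ≤ ENNReal.ofReal B := by
    intro u
    set U := empCDF u s' - empCDF u s with hU
    set w := (3 / 2) * c * Real.sqrt n with hw
    have hw0 : 0 ≤ w := by positivity
    have hsub : (Prod.mk u ⁻¹' {ω | |a * (Wp ω s' - Wp ω s)| ≤ c}) ⊆
        {v : Fin n → ℝ | n * U - w ≤ cnt (Ioc s s') v ∧ (cnt (Ioc s s') v : ℝ) ≤ n * U + w} := by
      intro v hv
      have hv : |a * (Wp (u, v) s' - Wp (u, v) s)| ≤ c := hv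
      have e : Wp (u, v) s' - Wp (u, v) s = U - (cnt (Ioc s s') v : ℝ) / n := by
        rw [← emp_diff v hss]; simp only [Wp]; ring
      rw [e, abs_mul, abs_of_pos hapos] at hv
      have h3 : Real.sqrt n ≤ (3 / 2) * a := by
        have : Real.sqrt n ≤ (3 / 2) * Real.sqrt (n / 2) := by
          rw [Real.sqrt_le_left (by positivity), mul_pow, Real.sq_sqrt (by positivity)]
          linarith
        linarith
      have h4 : |U - (cnt (Ioc s s') v : ℝ) / n| * n ≤ w := by
        have hsq : Real.sqrt n * Real.sqrt n = n := Real.mul_self_sqrt hn'.le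
        calc |U - (cnt (Ioc s s') v : ℝ) / n| * n
            = |U - (cnt (Ioc s s') v : ℝ) / n| * Real.sqrt n * Real.sqrt n := by
              rw [mul_assoc, hsq]
          _ ≤ |U - (cnt (Ioc s s') v : ℝ) / n| * ((3 / 2) * a) * Real.sqrt n := by gcongr
          _ = (3 / 2) * (a * |U - (cnt (Ioc s s') v : ℝ) / n|) * Real.sqrt n := by ring
          _ ≤ _ := by rw [hw]; gcongr
      have h5 : |U - (cnt (Ioc s s') v : ℝ) / n| * n = |n * U - cnt (Ioc s s') v| := by
        rw [← abs_of_pos hn', ← abs_mul, abs_of_pos hn']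
        congr 1
        field_simp
      rw [h5, abs_le] at h4
      constructor <;> linarith [h4.1, h4.2]
    have hb := bin_win (n := n) hn (measurableSet_Ioc (a := s) (b := s')) (n * U - w) (n * U + w)
      (by linarith) (by rw [hp]; linarith) (by rw [hp]; linarith)
    rw [hp] at hb
    refine (measure_mono hsub).trans ?_
    rw [← ofReal_measureReal]
    apply ENNReal.ofReal_le_ofReal
    refine hb.trans ?_
    rw [hB]
    have e : n * U + w - (n * U - w) + 1 = 3 * c * Real.sqrt n + 1 := by rw [hw]; ring
    rw [e]
    gcongr
    nlinarith
  refine (lintegral_mono key).trans ?_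
  simp

lemma bad_meas (θ : ℝ) (hθ : 0 < θ) :
    (lam.prod lam) {q | |q.1 - q.2| < θ ∨ 1 - θ < |q.1 - q.2|} ≤ ENNReal.ofReal (4 * θ) := by
  have hm : MeasurableSet {q : ℝ × ℝ | |q.1 - q.2| < θ ∨ 1 - θ < |q.1 - q.2|} := by
    have h : Measurable fun q : ℝ × ℝ => |q.1 - q.2| := by fun_prop
    exact (measurableSet_lt h measurable_const).union (measurableSet_lt measurable_const h)
  rw [Measure.prod_apply hm]
  have key : ∀ᵐ s ∂lam, lam (Prod.mk s ⁻¹' {q : ℝ × ℝ | |q.1 - q.2| < θ ∨ 1 - θ < |q.1 - q.2|}) ≤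
      ENNReal.ofReal (4 * θ) := by
    filter_upwards [lam_ae_Ioo] with s hs
    have hm' := measurable_prodMk_left (x := s) hm
    unfold lam
    rw [Measure.restrict_apply hm']
    have hsub : Prod.mk s ⁻¹' {q : ℝ × ℝ | |q.1 - q.2| < θ ∨ 1 - θ < |q.1 - q.2|} ∩ Ioc 0 1 ⊆
        Ioo (s - θ) (s + θ) ∪ Ioc 0 θ ∪ Ioc (1 - θ) 1 := by
      rintro t ⟨h | h, ht⟩
      · left; left
        have h : |s - t| < θ := h
        rw [abs_lt] at h
        constructor <;> linarith [h.1, h.2]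
      · have h : 1 - θ < |s - t| := h
        rcases lt_abs.1 h with h | h
        · left; right
          exact ⟨ht.1, by linarith [hs.2]⟩
        · right
          exact ⟨by linarith [hs.1], ht.2⟩
    refine (measure_mono hsub).trans ?_
    refine (measure_union_le _ _).trans ?_
    refine (add_le_add_left (measure_union_le _ _) _).trans ?_
    rw [Real.volume_Ioo, Real.volume_Ioc, Real.volume_Ioc, ← ENNReal.ofReal_add, ← ENNReal.ofReal_add]
    · apply ENNReal.ofReal_le_ofReal; linarith
    all_goals linarith
  refine (lintegral_mono_ae key).trans ?_
  simp

lemma anticonc {m n : ℕ} (hm : 0 < m) (hn : 0 < n) (a x c δ θ : ℝ) (hδ : 0 < δ) (hc : 0 < c)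
    (hθ : 0 < θ) (ha : Real.sqrt (n / 2) ≤ a) :
    (Lam m n).real {ω | a * KSstat ω.1 ω.2 ∈ Ioc (x - c) x} ≤
      δ + δ⁻¹ * ((3 * c * Real.sqrt n + 1) / Real.sqrt (n * (θ / 2)) + 4 * θ) := by
  have hn' : (0:ℝ) < n := by exact_mod_cast hn
  set B := (3 * c * Real.sqrt n + 1) / Real.sqrt (n * (θ / 2)) with hB
  have hB0 : 0 ≤ B := by positivity
  apply ENNReal.toReal_le_of_le_ofReal (by positivity)
  rw [ENNReal.ofReal_add hδ.le (by positivity), ENNReal.ofReal_mul (by positivity),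
    ENNReal.ofReal_inv_of_pos hδ, ENNReal.ofReal_add hB0 (by positivity)]
  refine (occ hm hn a x c δ hδ).trans ?_
  gcongr
  set bad := {q : ℝ × ℝ | |q.1 - q.2| < θ ∨ 1 - θ < |q.1 - q.2|} with hbad
  have hmb : MeasurableSet bad := by
    have h : Measurable fun q : ℝ × ℝ => |q.1 - q.2| := by fun_prop
    exact (measurableSet_lt h measurable_const).union (measurableSet_lt measurable_const h)
  have key : ∀ᵐ q ∂(lam.prod lam), Lam m n {ω | |a * (Wp ω q.1 - Wp ω q.2)| ≤ c} ≤
      ENNReal.ofReal B + bad.indicator 1 q := by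
    filter_upwards [Measure.quasiMeasurePreserving_fst.ae lam_ae_Ioo,
      Measure.quasiMeasurePreserving_snd.ae lam_ae_Ioo] with q h1 h2
    by_cases hq : q ∈ bad
    · refine le_trans ?_ le_add_self
      simp only [hq, indicator_of_mem, Pi.one_apply]
      exact prob_le_one
    · refine le_trans ?_ le_self_add
      simp only [hbad, mem_ofPred_eq, not_or, not_lt] at hq
      rcases le_total q.1 q.2 with h | h
      · rw [abs_of_nonpos (by linarith)] at hq
        have := pair_bd (m := m) hn a c θ hc hθ ha q.1 q.2 h1.1.le h2.2.le (by linarith [hq.1])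
          (by linarith [hq.2])
        refine le_trans (le_of_eq ?_) this
        congr 1
        ext ω
        simp only [mem_ofPred_eq]
        rw [← abs_neg]
        ring_nf
      · rw [abs_of_nonneg (by linarith)] at hq
        exact pair_bd (m := m) hn a c θ hc hθ ha q.2 q.1 h2.1.le h1.2.le (by linarith [hq.1])
          (by linarith [hq.2])
  refine (lintegral_mono_ae key).trans ?_
  rw [lintegral_add_left measurable_const, lintegral_indicator_one hmb]
  simp only [lintegral_const, measure_univ, mul_one]
  gcongr
  exact bad_meas θ hθ

lemma anticonc_lim (κ : ℝ) (hκ : 0 < κ) : ∃ c > 0, ∃ N : ℕ, ∀ n ≥ N, ∀ m > 0, ∀ a x : ℝ,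
    Real.sqrt (n / 2) ≤ a →
    (Lam m n).real {ω | a * KSstat ω.1 ω.2 ∈ Ioc (x - c) x} ≤ κ := by
  set δ := κ / 2 with hδ
  have hδ0 : 0 < δ := by positivity
  set θ := δ ^ 2 / 8 with hθ
  have hθ0 : 0 < θ := by positivity
  set c := δ ^ 2 / 8 * Real.sqrt (θ / 2) with hc
  have hc0 : 0 < c := by positivity
  obtain ⟨N, hN⟩ := exists_nat_ge (1 / c ^ 2)
  refine ⟨c, hc0, max N 1, fun n hn m hm a x ha => ?_⟩
  have hn1 : 0 < n := lt_of_lt_of_le one_pos ((le_max_right _ _).trans hn)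
  have hn2 : 1 / c ^ 2 ≤ n := hN.trans (by exact_mod_cast (le_max_left _ _).trans hn)
  have hn' : (0:ℝ) < n := by exact_mod_cast hn1
  refine (anticonc hm hn1 a x c δ θ hδ0 hc0 hθ0 ha).trans ?_
  have h1 : 1 ≤ c * Real.sqrt n := by
    rw [← Real.sqrt_sq hc0.le, ← Real.sqrt_mul (by positivity)]
    apply Real.one_le_sqrt.2
    rw [div_le_iff₀ (by positivity)] at hn2
    linarith
  have h2 : (3 * c * Real.sqrt n + 1) / Real.sqrt (n * (θ / 2)) ≤ δ ^ 2 / 2 := by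
    rw [div_le_iff₀ (by positivity), Real.sqrt_mul hn'.le]
    have : δ ^ 2 / 2 * (Real.sqrt n * Real.sqrt (θ / 2)) = 4 * c * Real.sqrt n := by
      rw [hc]; ring
    rw [this]; linarith
  have h3 : (3 * c * Real.sqrt n + 1) / Real.sqrt (n * (θ / 2)) + 4 * θ ≤ δ ^ 2 := by
    rw [hθ] at *; linarith
  calc δ + δ⁻¹ * ((3 * c * Real.sqrt n + 1) / Real.sqrt (n * (θ / 2)) + 4 * θ)
      ≤ δ + δ⁻¹ * δ ^ 2 := by gcongr
    _ = κ := by rw [hδ]; field_simp; ring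

/-- event of a large increment -/
def badSet (n : ℕ) (δ b : ℝ) : Set (Fin n → ℝ) :=
  {v | ∃ g f : ℝ, 0 ≤ g ∧ g ≤ f ∧ f ≤ 1 ∧ f - g ≤ δ ∧ b ≤ cnt (Ioc g f) v}

lemma cnt_mono {n : ℕ} {A B : Set ℝ} (h : A ⊆ B) (v : Fin n → ℝ) : cnt A v ≤ cnt B v := by
  unfold cnt
  refine Finset.sum_le_sum fun i _ => ?_
  exact indicator_le_indicator_of_subset h (fun _ => by norm_num) _

lemma bad_bound (n K : ℕ) (hK : 0 < K) (δ b : ℝ) (hδ : δ ≤ 1 / K) :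
    (Measure.pi fun _ : Fin n => lam).real (badSet n δ b) ≤
      (K + 1) * Real.exp (4 * n / K - b) := by
  have hK' : (0:ℝ) < K := by exact_mod_cast hK
  have hsub : badSet n δ b ⊆ ⋃ j ∈ Finset.range (K + 1),
      {v | b ≤ (cnt (Ioc ((j:ℝ) / K) (((j:ℝ) + 2) / K)) v : ℝ)} := by
    rintro v ⟨g, f, hg, hgf, hf, hd, hb⟩
    simp only [mem_iUnion, Finset.mem_range]
    have hgK : 0 ≤ g * K := by positivity
    refine ⟨⌊g * K⌋₊, ?_, ?_⟩
    · rw [Nat.lt_succ_iff]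
      apply Nat.floor_le_of_le
      nlinarith
    · refine hb.trans ?_
      have : cnt (Ioc g f) v ≤ cnt (Ioc ((⌊g * K⌋₊:ℝ) / K) (((⌊g * K⌋₊:ℝ) + 2) / K)) v := by
        apply cnt_mono
        apply Ioc_subset_Ioc
        · rw [div_le_iff₀ hK']
          exact Nat.floor_le hgK
        · rw [le_div_iff₀ hK']
          have h1 := Nat.lt_floor_add_one (g * K)
          have h2 : (f - g) * K ≤ 1 := by
            have := mul_le_mul_of_nonneg_right (hd.trans hδ) hK'.le
            rwa [one_div, inv_mul_cancel₀ hK'.ne'] at this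
          linarith
      exact_mod_cast this
  refine (measureReal_mono hsub (measure_ne_top _ _)).trans ?_
  refine (measureReal_biUnion_finset_le _ _).trans ?_
  have hj : ∀ j ∈ Finset.range (K + 1), (Measure.pi fun _ : Fin n => lam).real
      {v | b ≤ (cnt (Ioc ((j:ℝ) / K) (((j:ℝ) + 2) / K)) v : ℝ)} ≤ Real.exp (4 * n / K - b) := by
    intro j _
    refine (chernoff measurableSet_Ioc b).trans ?_
    have : lam.real (Ioc ((j:ℝ) / K) (((j:ℝ) + 2) / K)) ≤ 2 / K := by
      unfold lam
      have hle : ((volume : Measure ℝ).restrict (Ioc 0 1)).real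
          (Ioc ((j:ℝ) / K) (((j:ℝ) + 2) / K)) ≤
          (volume : Measure ℝ).real (Ioc ((j:ℝ) / K) (((j:ℝ) + 2) / K)) :=
        ENNReal.toReal_mono (by simp) (Measure.restrict_le_self _)
      refine hle.trans ?_
      · rw [Real.volume_real_Ioc_of_le (by gcongr; linarith)]
        apply le_of_eq; ring
    apply Real.exp_le_exp.2
    have e : 4 * (n:ℝ) / K = 2 * n * (2 / K) := by ring
    rw [e]
    gcongr
  refine (Finset.sum_le_sum hj).trans ?_
  simp

lemma bad_lim (δ : ℕ → ℝ) (hδ : Tendsto (fun n : ℕ => Real.sqrt n * δ n) atTop (𝓝 0)) (hδ0 : ∀ n, 0 ≤ δ n)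
    (c : ℝ) (hc : 0 < c) :
    Tendsto (fun n => (Measure.pi fun _ : Fin n => lam).real (badSet n (δ n) (c * Real.sqrt n)))
      atTop (𝓝 0) := by
  have hsq : Tendsto (fun n : ℕ => Real.sqrt n) atTop atTop :=
    Real.tendsto_sqrt_atTop.comp tendsto_natCast_atTop_atTop
  have hlim : Tendsto (fun n : ℕ => (8 / c * Real.sqrt n + 2) * Real.exp (-(c / 2) * Real.sqrt n))
      atTop (𝓝 0) := by
    have h1 : Tendsto (fun y : ℝ => (8 / c * y + 2) * Real.exp (-(c / 2) * y)) atTop (𝓝 0) := by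
      have a1 := Real.tendsto_pow_mul_exp_neg_atTop_nhds_zero 1
      have a0 := Real.tendsto_pow_mul_exp_neg_atTop_nhds_zero 0
      have hy : Tendsto (fun y : ℝ => (c / 2) * y) atTop atTop :=
        tendsto_id.const_mul_atTop (by positivity)
      have b1 := ((a1.comp hy).const_mul (16 / c ^ 2)).add ((a0.comp hy).const_mul 2)
      simp only [mul_zero, add_zero] at b1
      refine b1.congr fun y => ?_
      simp only [Function.comp, pow_one, pow_zero, one_mul]
      have : -(c / 2) * y = -(c / 2 * y) := by ring
      rw [this]
      field_simp
      ring
    exact h1.comp hsq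
  refine tendsto_of_tendsto_of_tendsto_of_le_of_le' tendsto_const_nhds hlim
    (Eventually.of_forall fun n => measureReal_nonneg) ?_
  have hev : ∀ᶠ n : ℕ in atTop, Real.sqrt n * δ n < 1 / (8 / c + 1) :=
    hδ.eventually (gt_mem_nhds (by positivity))
  filter_upwards [hev, eventually_ge_atTop 1] with n hn hn1
  have hn1' : (1:ℝ) ≤ n := by exact_mod_cast hn1
  have hs1 : 1 ≤ Real.sqrt n := Real.one_le_sqrt.2 hn1'
  set K := ⌈8 / c * Real.sqrt n⌉₊ with hK
  have hpos : 0 < 8 / c * Real.sqrt n := by positivity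
  have hK0 : 0 < K := Nat.ceil_pos.2 hpos
  have hK' : (0:ℝ) < K := by exact_mod_cast hK0
  have hKl : 8 / c * Real.sqrt n ≤ K := Nat.le_ceil _
  have hKu : (K:ℝ) < 8 / c * Real.sqrt n + 1 := Nat.ceil_lt_add_one hpos.le
  have hd : δ n ≤ 1 / K := by
    rw [le_div_iff₀ hK']
    rw [lt_div_iff₀ (by positivity)] at hn
    have h1 : (K:ℝ) ≤ (8 / c + 1) * Real.sqrt n := by linarith
    have := mul_le_mul_of_nonneg_left h1 (hδ0 n)
    linarith
  refine (bad_bound n K hK0 (δ n) _ hd).trans ?_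
  apply mul_le_mul _ _ (Real.exp_pos _).le (by positivity)
  · linarith
  · apply Real.exp_le_exp.2
    have hss : Real.sqrt n * Real.sqrt n = n := Real.mul_self_sqrt (by positivity)
    have : 4 * (n:ℝ) / K ≤ c / 2 * Real.sqrt n := by
      rw [div_le_iff₀ hK']
      have := mul_le_mul_of_nonneg_left hKl (show 0 ≤ c / 2 * Real.sqrt n by positivity)
      have e : c / 2 * Real.sqrt n * (8 / c * Real.sqrt n) = 4 * n := by
        calc _ = 4 * (Real.sqrt n * Real.sqrt n) := by field_simp; ring
          _ = _ := by rw [hss]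
      linarith
    linarith

lemma quantile (P : Measure ℝ) [IsProbabilityMeasure P]
    (F : ℝ → ℝ) (hF : ∀ t, F t = P.real (Iic t)) (hFc : Continuous F) :
    ∃ q : ℝ → ℝ, MeasurePreserving q lam P ∧ ∀ u ∈ Ioo (0:ℝ) 1, ∀ t, q u ≤ t ↔ u ≤ F t := by
  have hFe : F = cdf P := by ext t; rw [hF, cdf_eq_real]
  have hmono : Monotone F := by rw [hFe]; exact monotone_cdf P
  have h0 : Tendsto F atBot (𝓝 0) := by rw [hFe]; exact tendsto_cdf_atBot P
  have h1 : Tendsto F atTop (𝓝 1) := by rw [hFe]; exact tendsto_cdf_atTop P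
  classical
  let q : ℝ → ℝ := fun u => if u ∈ Ioo (0:ℝ) 1 then sInf {t | u ≤ F t} else 0
  have hq : ∀ u ∈ Ioo (0:ℝ) 1, ∀ t, q u ≤ t ↔ u ≤ F t := by
    intro u hu t
    have hqu : q u = sInf {t | u ≤ F t} := if_pos hu
    have hne : {t | u ≤ F t}.Nonempty := by
      obtain ⟨t, ht⟩ := (h1.eventually (lt_mem_nhds hu.2)).exists
      exact ⟨t, ht.le⟩
    have hbd : BddBelow {t | u ≤ F t} := by
      obtain ⟨b, hb⟩ := (h0.eventually (gt_mem_nhds hu.1)).exists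
      refine ⟨b, fun t ht => ?_⟩
      by_contra hcon
      have := hmono (not_le.1 hcon).le
      have ht : u ≤ F t := ht
      linarith
    have hcl : IsClosed {t | u ≤ F t} := isClosed_le continuous_const hFc
    rw [hqu]
    constructor
    · intro h
      have hmem : u ≤ F (sInf {t | u ≤ F t}) := hcl.csInf_mem hne hbd
      exact hmem.trans (hmono h)
    · intro h
      exact csInf_le hbd h
  have hqm : Measurable q := by
    refine measurable_of_Iic fun t => ?_
    have : q ⁻¹' Iic t = (Ioo 0 1 ∩ Iic (F t)) ∪ ((Ioo 0 1)ᶜ ∩ {_u | 0 ≤ t}) := by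
      ext u
      by_cases hu : u ∈ Ioo (0:ℝ) 1
      · simp only [mem_preimage, mem_Iic, hq u hu t, mem_union, mem_inter_iff, hu, true_and,
          mem_compl_iff, not_true, false_and, or_false]
      · have : q u = 0 := if_neg hu
        simp only [mem_preimage, mem_Iic, this, mem_union, mem_inter_iff, hu, false_and,
          mem_compl_iff, not_false_iff, true_and, false_or, mem_ofPred_eq]
    rw [this]
    exact (measurableSet_Ioo.inter measurableSet_Iic).union
      (measurableSet_Ioo.compl.inter (MeasurableSet.const _))
  refine ⟨q, ⟨hqm, ?_⟩, hq⟩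
  have : IsProbabilityMeasure (lam.map q) := Measure.isProbabilityMeasure_map hqm.aemeasurable
  refine Measure.ext_of_Iic _ _ fun t => ?_
  rw [Measure.map_apply hqm measurableSet_Iic]
  have e1 : lam (q ⁻¹' Iic t) = lam (Iic (F t)) := by
    apply measure_congr
    filter_upwards [lam_ae_Ioo] with u hu
    apply propext
    exact hq u hu t
  have hF0 : 0 ≤ F t := by rw [hF]; exact measureReal_nonneg
  have hF1 : F t ≤ 1 := by rw [hF]; exact measureReal_le_one
  have e2 : Iic (F t) ∩ Ioc 0 1 = Ioc 0 (F t) := by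
    ext u; simp only [mem_inter_iff, mem_Iic, mem_Ioc]
    constructor
    · rintro ⟨a, b, c⟩; exact ⟨b, a⟩
    · rintro ⟨a, b⟩; exact ⟨b, a, b.trans hF1⟩
  rw [e1, lam, Measure.restrict_apply measurableSet_Iic, e2, Real.volume_Ioc, sub_zero, hF,
    ofReal_measureReal]

lemma emp_q {k : ℕ} (q F : ℝ → ℝ) (hq : ∀ u ∈ Ioo (0:ℝ) 1, ∀ t, q u ≤ t ↔ u ≤ F t)
    (u : Fin k → ℝ) (hu : ∀ i, u i ∈ Ioo (0:ℝ) 1) (t : ℝ) :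
    empCDF (fun i => q (u i)) t = empCDF u (F t) := by
  unfold empCDF
  simp only [hq _ (hu _)]

lemma compare {m n : ℕ} (hm : 0 < m) (hn : 0 < n) (P Q : Measure ℝ) [IsProbabilityMeasure P]
    [IsProbabilityMeasure Q]
    (F G : ℝ → ℝ) (hF : ∀ t, F t = P.real (Iic t)) (hFc : Continuous F)
    (hG : ∀ t, G t = Q.real (Iic t)) (hGc : Continuous G) (δ : ℝ)
    (hGF : ∀ t, G t ≤ F t) (hd : ∀ t, F t - G t ≤ δ) (a c x : ℝ) (ha0 : 0 < a)
    (ha : a ≤ Real.sqrt n) (hc : 0 < c) :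
    |((Measure.pi fun _ : Fin m => P).prod (Measure.pi fun _ : Fin n => Q)).real
        {ω | a * KSstat ω.1 ω.2 ≤ x} -
      ((Measure.pi fun _ : Fin m => P).prod (Measure.pi fun _ : Fin n => P)).real
        {ω | a * KSstat ω.1 ω.2 ≤ x}| ≤
      (Lam m n).real {ω | a * KSstat ω.1 ω.2 ∈ Ioc (x - c) x} +
      (Measure.pi fun _ : Fin n => lam).real (badSet n δ (c * Real.sqrt n)) := by
  obtain ⟨qF, mF, hqF⟩ := quantile P F hF hFc
  obtain ⟨qG, mG, hqG⟩ := quantile Q G hG hGc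
  have hn' : (0:ℝ) < n := by exact_mod_cast hn
  have hFe : F = cdf P := by ext t; rw [hF, cdf_eq_real]
  have h0 : Tendsto F atBot (𝓝 0) := by rw [hFe]; exact tendsto_cdf_atBot P
  have h1 : Tendsto F atTop (𝓝 1) := by rw [hFe]; exact tendsto_cdf_atTop P
  have hmS : MeasurableSet {ω : (Fin m → ℝ) × (Fin n → ℝ) | a * KSstat ω.1 ω.2 ≤ x} :=
    (measurable_KS.const_mul a) measurableSet_Iic
  have p0 : MeasurePreserving (Prod.map (fun (u : Fin m → ℝ) i => qF (u i))
      (fun (u : Fin n → ℝ) i => qF (u i))) (Lam m n)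
      ((Measure.pi fun _ : Fin m => P).prod (Measure.pi fun _ : Fin n => P)) :=
    (measurePreserving_pi _ _ fun _ => mF).prod (measurePreserving_pi _ _ fun _ => mF)
  have p1 : MeasurePreserving (Prod.map (fun (u : Fin m → ℝ) i => qF (u i))
      (fun (u : Fin n → ℝ) i => qG (u i))) (Lam m n)
      ((Measure.pi fun _ : Fin m => P).prod (Measure.pi fun _ : Fin n => Q)) :=
    (measurePreserving_pi _ _ fun _ => mF).prod (measurePreserving_pi _ _ fun _ => mG)
  rw [← p0.measureReal_preimage hmS.nullMeasurableSet,
    ← p1.measureReal_preimage hmS.nullMeasurableSet]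
  set A0 := Prod.map (fun (u : Fin m → ℝ) i => qF (u i)) (fun (u : Fin n → ℝ) i => qF (u i)) ⁻¹'
    {ω | a * KSstat ω.1 ω.2 ≤ x} with hA0
  set A1 := Prod.map (fun (u : Fin m → ℝ) i => qF (u i)) (fun (u : Fin n → ℝ) i => qG (u i)) ⁻¹'
    {ω | a * KSstat ω.1 ω.2 ≤ x} with hA1
  set E := {ω : (Fin m → ℝ) × (Fin n → ℝ) | a * KSstat ω.1 ω.2 ∈ Ioc (x - c) x} with hE
  set Bd : Set ((Fin m → ℝ) × (Fin n → ℝ)) := univ ×ˢ badSet n δ (c * Real.sqrt n) with hBd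
  have hKS : ∀ ω : (Fin m → ℝ) × (Fin n → ℝ), (∀ i, ω.1 i ∈ Ioo (0:ℝ) 1) →
      (∀ i, ω.2 i ∈ Ioo (0:ℝ) 1) →
      KSstat (fun i => qF (ω.1 i)) (fun i => qF (ω.2 i)) = KSstat ω.1 ω.2 := by
    intro ω hu hv
    apply le_antisymm
    · refine KS_le _ _ _ fun t => ?_
      rw [emp_q qF F hqF _ hu, emp_q qF F hqF _ hv]
      exact le_KS _ _ _
    · refine KS_le _ _ _ fun s => ?_
      by_cases hs0 : 0 < s
      · by_cases hs1 : s < 1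
        · obtain ⟨t1, ht1⟩ := (h0.eventually (gt_mem_nhds hs0)).exists
          obtain ⟨t2, ht2⟩ := (h1.eventually (lt_mem_nhds hs1)).exists
          obtain ⟨t, rfl⟩ := mem_range_of_exists_le_of_exists_ge hFc ⟨t1, ht1.le⟩ ⟨t2, ht2.le⟩
          rw [← emp_q qF F hqF _ hu, ← emp_q qF F hqF _ hv]
          exact le_KS _ _ _
        · rw [empCDF_eq_one hm _ s (fun i => by linarith [(hu i).2]),
            empCDF_eq_one hn _ s (fun i => by linarith [(hv i).2]), sub_self]
          exact KS_nonneg _ _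
      · rw [empCDF_eq_zero _ s (fun i => by linarith [(hu i).1]),
          empCDF_eq_zero _ s (fun i => by linarith [(hv i).1]), sub_self]
        exact KS_nonneg _ _
  have s1 : A1 ≤ᵐ[Lam m n] A0 := by
    filter_upwards [Lam_ae m n] with ω hω h
    have h : a * KSstat (fun i => qF (ω.1 i)) (fun i => qG (ω.2 i)) ≤ x := h
    change a * KSstat (fun i => qF (ω.1 i)) (fun i => qF (ω.2 i)) ≤ x
    refine le_trans ?_ h
    apply mul_le_mul_of_nonneg_left _ ha0.le
    refine KS_le _ _ _ fun t => le_trans ?_ (le_KS _ _ t)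
    rw [emp_q qF F hqF _ hω.2, emp_q qG G hqG _ hω.2]
    have := empCDF_mono ω.2 (hGF t)
    linarith
  have s2 : A0 ≤ᵐ[Lam m n] (A1 ∪ (E ∪ Bd) : Set _) := by
    filter_upwards [Lam_ae m n] with ω hω h
    have h : a * KSstat (fun i => qF (ω.1 i)) (fun i => qF (ω.2 i)) ≤ x := h
    rw [hKS ω hω.1 hω.2] at h
    by_contra hcon
    have hcon : ω ∉ A1 ∪ (E ∪ Bd) := hcon
    simp only [mem_union, not_or] at hcon
    obtain ⟨n1, n2, n3⟩ := hcon
    have n2' : a * KSstat ω.1 ω.2 ≤ x - c := by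
      by_contra hh
      exact n2 ⟨not_le.1 hh, h⟩
    apply n1
    change a * KSstat (fun i => qF (ω.1 i)) (fun i => qG (ω.2 i)) ≤ x
    have n3' : ω.2 ∉ badSet n δ (c * Real.sqrt n) := fun hh => n3 ⟨trivial, hh⟩
    have hsq : Real.sqrt n * Real.sqrt n = n := Real.mul_self_sqrt hn'.le
    have hsp : 0 < Real.sqrt n := Real.sqrt_pos.2 hn'
    have hle : KSstat (fun i => qF (ω.1 i)) (fun i => qG (ω.2 i)) ≤
        KSstat ω.1 ω.2 + c / Real.sqrt n := by
      refine KS_le _ _ _ fun t => ?_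
      rw [emp_q qF F hqF _ hω.1, emp_q qG G hqG _ hω.2]
      have h5 := le_KS ω.1 ω.2 (F t)
      have h6 := emp_diff ω.2 (hGF t)
      have h7 : (cnt (Ioc (G t) (F t)) ω.2 : ℝ) ≤ c * Real.sqrt n := by
        by_contra hh
        refine n3' ⟨G t, F t, ?_, hGF t, ?_, hd t, (not_le.1 hh).le⟩
        · rw [hG]; exact measureReal_nonneg
        · rw [hF]; exact measureReal_le_one
      have h8 : (cnt (Ioc (G t) (F t)) ω.2 : ℝ) / n ≤ c / Real.sqrt n := by
        rw [div_le_div_iff₀ hn' hsp]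
        calc _ ≤ c * Real.sqrt n * Real.sqrt n := by gcongr
          _ = _ := by rw [mul_assoc, hsq]
      linarith
    have h9 : a * (c / Real.sqrt n) ≤ c := by
      rw [mul_div_assoc', div_le_iff₀ hsp]
      nlinarith
    have := mul_le_mul_of_nonneg_left hle ha0.le
    linarith
  have r1 : (Lam m n).real A1 ≤ (Lam m n).real A0 :=
    ENNReal.toReal_mono (measure_ne_top _ _) (measure_mono_ae s1)
  have r2 : (Lam m n).real A0 ≤ (Lam m n).real (A1 ∪ (E ∪ Bd)) :=
    ENNReal.toReal_mono (measure_ne_top _ _) (measure_mono_ae s2)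
  have r3 := measureReal_union_le (μ := Lam m n) A1 (E ∪ Bd)
  have r4 := measureReal_union_le (μ := Lam m n) E Bd
  have r5 : (Lam m n).real Bd = (Measure.pi fun _ : Fin n => lam).real
      (badSet n δ (c * Real.sqrt n)) := by
    unfold Measure.real Lam
    rw [hBd, Measure.prod_prod]; simp
  rw [abs_le]
  constructor <;> linarith

theorem stmt_5
    (P : Measure ℝ) [IsProbabilityMeasure P]
    (F : ℝ → ℝ) (hF : ∀ t, F t = (P (Set.Iic t)).toReal) (hFcont : Continuous F)
    (ε μ : ℕ → ℝ) (hε : ∀ n, ε n ∈ Set.Ioo (0:ℝ) (1/2)) (hμ : ∀ n, 0 < μ n)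
    (η : ℝ) (hη : η ∈ Set.Ioc (0:ℝ) (1/2))
    (m : ℕ → ℕ) (hmn : ∀ᶠ n in atTop, n ≤ m n)
    (hcouple : (fun n : ℕ => (n : ℝ) / ((m n : ℝ) + n) - η)
      =O[atTop] fun n => Real.log n / Real.sqrt n)
    (Q : ℕ → Measure ℝ) [∀ n, IsProbabilityMeasure (Q n)]
    (hQ : ∀ n, Q n = ENNReal.ofReal (1 - ε n) • P + ENNReal.ofReal (ε n) • P.map (· + μ n))
    (h : Tendsto (fun n : ℕ => Real.sqrt n * ε n *
      ⨆ t : ℝ, (F t - F (t - μ n))) atTop (𝓝 0)) :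
    ∀ x : ℝ,
      Tendsto (fun n =>
        (((Measure.pi fun _ : Fin (m n) => P).prod (Measure.pi fun _ : Fin n => Q n))
          {ω | Real.sqrt (((m n : ℝ) * n) / ((m n : ℝ) + n)) * KSstat ω.1 ω.2 ≤ x}).toReal -
        (((Measure.pi fun _ : Fin (m n) => P).prod (Measure.pi fun _ : Fin n => P))
          {ω | Real.sqrt (((m n : ℝ) * n) / ((m n : ℝ) + n)) * KSstat ω.1 ω.2 ≤ x}).toReal)
        atTop (𝓝 0) := by
  intro x
  have hF' : ∀ t, F t = P.real (Iic t) := hF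
  have hmono : Monotone F := fun s t hst => by
    rw [hF', hF']; exact measureReal_mono (Iic_subset_Iic.2 hst) (measure_ne_top _ _)
  have hbdd : ∀ n, BddAbove (range fun t => F t - F (t - μ n)) := by
    intro n
    refine ⟨1, ?_⟩
    rintro _ ⟨t, rfl⟩
    have h1 : F t ≤ 1 := by rw [hF']; exact measureReal_le_one
    have h2 : 0 ≤ F (t - μ n) := by rw [hF']; exact measureReal_nonneg
    simp only; linarith
  have hinc : ∀ n t, 0 ≤ F t - F (t - μ n) := fun n t => by
    have := hmono (show t - μ n ≤ t by linarith [hμ n])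
    linarith
  set D : ℕ → ℝ := fun n => ⨆ t : ℝ, (F t - F (t - μ n)) with hD
  set δ : ℕ → ℝ := fun n => ε n * D n with hδ
  have hδ0 : ∀ n, 0 ≤ δ n := fun n =>
    mul_nonneg (hε n).1.le (Real.iSup_nonneg (hinc n))
  have hδlim : Tendsto (fun n : ℕ => Real.sqrt n * δ n) atTop (𝓝 0) := by
    refine h.congr fun n => ?_
    simp only [hδ]; ring
  set G : ℕ → ℝ → ℝ := fun n t => (1 - ε n) * F t + ε n * F (t - μ n) with hGdef
  have hG : ∀ n t, G n t = (Q n).real (Iic t) := by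
    intro n t
    have h1 := (hε n).1
    have h2 := (hε n).2
    have e : (· + μ n) ⁻¹' Iic t = Iic (t - μ n) := by
      ext z; simp [le_sub_iff_add_le]
    have : (Q n) (Iic t) = ENNReal.ofReal (1 - ε n) * P (Iic t) +
        ENNReal.ofReal (ε n) * P (Iic (t - μ n)) := by
      rw [hQ n]
      simp only [Measure.add_apply, Measure.smul_apply, smul_eq_mul]
      rw [Measure.map_apply (by fun_prop) measurableSet_Iic, e]
    unfold Measure.real
    rw [this, ENNReal.toReal_add (by finiteness) (by finiteness), ENNReal.toReal_mul,
      ENNReal.toReal_mul, ENNReal.toReal_ofReal (by linarith), ENNReal.toReal_ofReal h1.le, ← hF,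
      ← hF]
  have hGc : ∀ n, Continuous (G n) := fun n => by simp only [hGdef]; fun_prop
  have hdiff : ∀ n t, F t - G n t = ε n * (F t - F (t - μ n)) := fun n t => by
    simp only [hGdef]; ring
  rw [Metric.tendsto_atTop']
  intro κ hκ
  obtain ⟨c, hc, N, hN⟩ := anticonc_lim (κ / 2) (by positivity)
  have hb := (bad_lim δ hδlim hδ0 c hc).eventually (gt_mem_nhds (show 0 < κ / 2 by positivity))
  obtain ⟨N', hN'⟩ := eventually_atTop.1 (hb.and (hmn.and ((eventually_ge_atTop N).and
    (eventually_ge_atTop 1))))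
  refine ⟨N', fun n hn => ?_⟩
  obtain ⟨q1, q2, q3, q4⟩ := hN' n hn.le
  have hn' : (0:ℝ) < n := by exact_mod_cast q4
  have hm0 : 0 < m n := lt_of_lt_of_le q4 q2
  have hm' : (0:ℝ) < m n := by exact_mod_cast hm0
  have hmn' : (n:ℝ) ≤ m n := by exact_mod_cast q2
  rw [Real.dist_eq, sub_zero]
  have a1 : Real.sqrt ((n:ℝ) / 2) ≤ Real.sqrt (((m n : ℝ) * n) / ((m n : ℝ) + n)) := by
    apply Real.sqrt_le_sqrt
    rw [div_le_div_iff₀ (by norm_num) (by positivity)]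
    nlinarith
  have a2 : Real.sqrt (((m n : ℝ) * n) / ((m n : ℝ) + n)) ≤ Real.sqrt n := by
    apply Real.sqrt_le_sqrt
    rw [div_le_iff₀ (by positivity)]
    nlinarith
  have key := compare hm0 q4 P (Q n) F (G n) hF' hFcont (hG n) (hGc n) (δ n)
    (fun t => by
      have := mul_nonneg (hε n).1.le (hinc n t)
      linarith [hdiff n t])
    (fun t => by
      rw [hdiff]
      exact mul_le_mul_of_nonneg_left (le_ciSup (hbdd n) t) (hε n).1.le)
    (Real.sqrt (((m n : ℝ) * n) / ((m n : ℝ) + n))) c x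
    (Real.sqrt_pos.2 (by positivity)) a2 hc
  have k2 := hN n q3 (m n) hm0 _ x a1
  refine lt_of_le_of_lt key ?_
  linarith
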